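/- Let K ⊆ ℝⁿ be a compact set with nonempty interior satisfying Assumption 1, equipped with the Lebesgue measure (weight w ≡ 1), and let f be an n-variate real polynomial. Then there exists a constant c > 0 (depending only on K and f) such that for every integer r ≥ 2 one has E^{(r)}_K(f) ≤ c · (log r) / r. -/

import Mathlib

open MeasureTheory

noncomputable section

/-- A polynomial is a sum of squares. -/
def IsSOS {n : ℕ} (q : MvPolynomial (Fin n) ℝ) : Prop :=
  ∃ (m : ℕ) (p : Fin m → MvPolynomial (Fin n) ℝ), q = ∑ i, p i ^ 2

/-- The Lasserre measure-based upper bound `f^{(r)}_{K,w}`: the infimum of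
`∫_K f q w dx` over sum-of-squares polynomials `q` of degree at most `2r`
with `∫_K q w dx = 1`. -/
noncomputable def lasserre {n : ℕ} (r : ℕ) (K : Set (EuclideanSpace ℝ (Fin n)))
    (w f : EuclideanSpace ℝ (Fin n) → ℝ) : ℝ :=
  sInf { v : ℝ | ∃ q : MvPolynomial (Fin n) ℝ, IsSOS q ∧ q.totalDegree ≤ 2 * r ∧
    (∫ x in K, MvPolynomial.eval (fun i => x i) q * w x) = 1 ∧
    v = ∫ x in K, f x * MvPolynomial.eval (fun i => x i) q * w x }

/-- The error `E^{(r)}_{K,w}(f) = f^{(r)}_{K,w} - min_{x ∈ K} f(x)`. -/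
noncomputable def lasserreError {n : ℕ} (r : ℕ) (K : Set (EuclideanSpace ℝ (Fin n)))
    (w f : EuclideanSpace ℝ (Fin n) → ℝ) : ℝ :=
  lasserre r K w f - sInf (f '' K)

/-- Assumption 1: there exist `ε_K, η_K > 0` such that
`vol(B_δ(x) ∩ K) ≥ η_K · δⁿ · vol(B₁(0))` for all `x ∈ K` and `0 < δ ≤ ε_K`. -/
def Assumption1 {n : ℕ} (K : Set (EuclideanSpace ℝ (Fin n))) : Prop :=
  ∃ εK ηK : ℝ, 0 < εK ∧ 0 < ηK ∧ ∀ x ∈ K, ∀ δ : ℝ, 0 < δ → δ ≤ εK →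
    ENNReal.ofReal (ηK * δ ^ n) *
        volume (Metric.closedBall (0 : EuclideanSpace ℝ (Fin n)) 1) ≤
      volume (Metric.closedBall x δ ∩ K)

theorem mul_one_sub_pow_le {u τ : ℝ} {r d k : ℕ} (hd : 0 < d) (hrd : r < d * (k + 1))
    (hu : u ≤ 1 / 2) (hτ : 0 ≤ τ) :
    u * (1 - u) ^ (2 * k) ≤ τ * (1 - u) ^ (2 * k) + 4 * Real.exp (-(2 * r * τ / d)) := by
  have hpow : 0 ≤ (1 - u) ^ (2 * k) := pow_nonneg (by linarith) _
  rcases le_total u τ with h | h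
  · have := mul_le_mul_of_nonneg_right h hpow
    have := Real.exp_pos (-(2 * r * τ / d))
    linarith
  have hd' : (0 : ℝ) < d := by exact_mod_cast hd
  have hdiv : (r : ℝ) / d ≤ k + 1 := by
    rw [div_le_iff₀ hd', mul_comm]
    exact_mod_cast hrd.le
  have hexp : (1 - u) ^ (2 * (k + 1)) ≤ Real.exp (-(2 * r * τ / d)) := by
    calc (1 - u) ^ (2 * (k + 1)) ≤ Real.exp (-u) ^ (2 * (k + 1)) :=
          pow_le_pow_left₀ (by linarith) (Real.one_sub_le_exp_neg u) _
      _ = Real.exp (-(2 * ((k + 1) * u))) := by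
          rw [← Real.exp_nat_mul]; congr 1; push_cast; ring
      _ ≤ Real.exp (-(2 * r * τ / d)) := by
          have : (r : ℝ) / d * τ ≤ (k + 1) * u := by gcongr
          apply Real.exp_le_exp.2
          have e : 2 * (r : ℝ) * τ / d = 2 * (r / d * τ) := by ring
          rw [e]; linarith
  have hsplit : (1 - u) ^ (2 * (k + 1)) = (1 - u) ^ (2 * k) * (1 - u) ^ 2 := by ring
  have hquarter : (1 / 4 : ℝ) ≤ (1 - u) ^ 2 := by nlinarith
  have h1 := mul_le_mul_of_nonneg_left hquarter hpow
  have h2 : u * (1 - u) ^ (2 * k) ≤ 1 * (1 - u) ^ (2 * k) := by gcongr; linarith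
  have h3 := mul_nonneg hτ hpow
  linarith

theorem differentiable_eval_mvPolynomial {n : ℕ} (f : MvPolynomial (Fin n) ℝ) :
    Differentiable ℝ
      (fun x : EuclideanSpace ℝ (Fin n) => MvPolynomial.eval (fun i => x i) f) := by
  induction f using MvPolynomial.induction_on with
  | C a => simp
  | add p q hp hq =>
    simp only [map_add]
    exact hp.add hq
  | mul_X p i hp =>
    simp only [map_mul, MvPolynomial.eval_X]
    exact hp.mul (by fun_prop)

/-- Sublevel sets of a function differentiable at a point of `K` have volume of order at
least `r ^ (-n)` at height `1 / r`. -/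
theorem exists_le_volume_sublevel {n : ℕ} {K : Set (EuclideanSpace ℝ (Fin n))}
    (hKc : IsCompact K) (hKa : Assumption1 K) {F : EuclideanSpace ℝ (Fin n) → ℝ}
    {x₀ : EuclideanSpace ℝ (Fin n)} (hx₀ : x₀ ∈ K) (hF : DifferentiableAt ℝ F x₀)
    {s : ℝ} (hs : 0 < s) :
    ∃ C : ℝ, 0 < C ∧ ∀ r : ℕ, 1 ≤ r →
      C / (r : ℝ) ^ n ≤ volume.real (K ∩ {x | F x ≤ F x₀ + s / r}) := by
  obtain ⟨ε, η, hε, hη, hvol⟩ := hKa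
  obtain ⟨L, hL, hLF⟩ := hF.isBigO_sub.exists_pos
  obtain ⟨ρ, hρ, hball⟩ := Metric.eventually_nhds_iff_ball.1 hLF.bound
  set δ₀ := min ε (min (ρ / 2) (s / L))
  have hδ₀ : 0 < δ₀ := by positivity
  have hV : 0 < volume.real (Metric.closedBall (0 : EuclideanSpace ℝ (Fin n)) 1) :=
    ENNReal.toReal_pos (Metric.measure_closedBall_pos _ _ one_pos).ne'
      measure_closedBall_lt_top.ne
  refine ⟨η * δ₀ ^ n * volume.real (Metric.closedBall (0 : EuclideanSpace ℝ (Fin n)) 1),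
    by positivity, fun r hr => ?_⟩
  have hr' : (1 : ℝ) ≤ r := by exact_mod_cast hr
  have hr0 : (0 : ℝ) < r := by linarith
  have hδ : δ₀ / r ≤ δ₀ := div_le_self hδ₀.le hr'
  have hsub : Metric.closedBall x₀ (δ₀ / r) ∩ K ⊆ K ∩ {x | F x ≤ F x₀ + s / r} := by
    rintro x ⟨hx, hxK⟩
    refine ⟨hxK, ?_⟩
    have hx' : dist x x₀ ≤ δ₀ / r := hx
    have hδρ : δ₀ ≤ ρ / 2 := (min_le_right _ _).trans (min_le_left _ _)
    have hδs : δ₀ ≤ s / L := (min_le_right _ _).trans (min_le_right _ _)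
    have h1 := hball x (Metric.mem_ball.2 (by linarith))
    rw [← dist_eq_norm x x₀, Real.norm_eq_abs] at h1
    have h2 : L * dist x x₀ ≤ L * (s / L / r) := by
      gcongr
      exact hx'.trans (by gcongr)
    have h3 : L * (s / L / r) = s / r := by field_simp
    have h4 := le_abs_self (F x - F x₀)
    change F x ≤ _
    linarith
  have hfin : volume (K ∩ {x | F x ≤ F x₀ + s / r}) ≠ ⊤ :=
    (measure_mono Set.inter_subset_left |>.trans_lt hKc.measure_lt_top).ne
  have h := (hvol x₀ hx₀ (δ₀ / r) (by positivity) (hδ.trans (min_le_left _ _))).trans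
    (measure_mono hsub)
  have h' := ENNReal.toReal_mono hfin h
  rw [ENNReal.toReal_mul, ENNReal.toReal_ofReal (by positivity)] at h'
  calc _ = η * (δ₀ / r) ^ n *
        volume.real (Metric.closedBall (0 : EuclideanSpace ℝ (Fin n)) 1) := by
        rw [div_pow]; ring
    _ ≤ _ := h'

theorem IsSOS.eval_nonneg {n : ℕ} {q : MvPolynomial (Fin n) ℝ} (hq : IsSOS q)
    (x : Fin n → ℝ) : 0 ≤ MvPolynomial.eval x q := by
  obtain ⟨m, p, rfl⟩ := hq
  simp only [map_sum, map_pow]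
  positivity

/-- A square of a polynomial, suitably normalized, bounds `lasserre` from above. -/
theorem lasserre_le_of_sq {n r : ℕ} {K : Set (EuclideanSpace ℝ (Fin n))} (hKc : IsCompact K)
    {F : EuclideanSpace ℝ (Fin n) → ℝ} (hF : Continuous F) {m : ℝ} (hm : ∀ x ∈ K, m ≤ F x)
    (p : MvPolynomial (Fin n) ℝ) (hp : p.totalDegree ≤ r)
    (hD : 0 < ∫ x in K, MvPolynomial.eval (fun i => x i) p ^ 2) :
    lasserre r K (fun _ => 1) F ≤ (∫ x in K, F x * MvPolynomial.eval (fun i => x i) p ^ 2) /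
      ∫ x in K, MvPolynomial.eval (fun i => x i) p ^ 2 := by
  set D := ∫ x in K, MvPolynomial.eval (fun i => x i) p ^ 2 with hDdef
  have hsq : (√D⁻¹) ^ 2 = D⁻¹ := Real.sq_sqrt (by positivity)
  apply csInf_le
  · refine ⟨m, ?_⟩
    rintro v ⟨q, hq, -, hq1, rfl⟩
    simp only [mul_one] at hq1 ⊢
    have hc := (differentiable_eval_mvPolynomial q).continuous
    calc m = ∫ x in K, m * MvPolynomial.eval (fun i => x i) q := by
          rw [integral_const_mul, hq1, mul_one]
      _ ≤ _ := setIntegral_mono_on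
          (Continuous.continuousOn (by fun_prop) |>.integrableOn_compact hKc)
          (Continuous.continuousOn (by fun_prop) |>.integrableOn_compact hKc)
          hKc.measurableSet
          fun x hx => mul_le_mul_of_nonneg_right (hm x hx) (hq.eval_nonneg _)
  · refine ⟨(MvPolynomial.C (√D⁻¹) * p) ^ 2, ⟨1, fun _ => MvPolynomial.C (√D⁻¹) * p, by simp⟩,
      ?_, ?_, ?_⟩
    · refine (MvPolynomial.totalDegree_pow _ _).trans ?_
      have h := MvPolynomial.totalDegree_mul (MvPolynomial.C (√D⁻¹)) p
      rw [MvPolynomial.totalDegree_C] at h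
      omega
    · simp only [map_pow, map_mul, MvPolynomial.eval_C, mul_one, mul_pow, hsq]
      rw [integral_const_mul, ← hDdef, inv_mul_cancel₀ hD.ne']
    · simp only [map_pow, map_mul, MvPolynomial.eval_C, mul_one, mul_pow, hsq]
      simp_rw [mul_left_comm _ D⁻¹]
      rw [integral_const_mul, div_eq_inv_mul]

/-- Theorem: for a compact `K ⊆ ℝⁿ` with nonempty interior satisfying Assumption 1,
equipped with the Lebesgue measure, the Lasserre error of any polynomial `f` is
`O(log r / r)`. -/
theorem stmt6 {n : ℕ}
    (K : Set (EuclideanSpace ℝ (Fin n)))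
    (hKc : IsCompact K) (hKi : (interior K).Nonempty)
    (hKa : Assumption1 K)
    (f : MvPolynomial (Fin n) ℝ)
    (F : EuclideanSpace ℝ (Fin n) → ℝ)
    (hF : ∀ x : EuclideanSpace ℝ (Fin n), F x = MvPolynomial.eval (fun i => x i) f) :
    ∃ c : ℝ, 0 < c ∧ ∀ r : ℕ, 2 ≤ r →
      lasserreError r K (fun _ => 1) F ≤ c * Real.log r / r := by
  have hFd : Differentiable ℝ F := by
    rw [funext hF]; exact differentiable_eval_mvPolynomial f
  have hFc := hFd.continuous
  have hKne : K.Nonempty := hKi.mono interior_subset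
  obtain ⟨x₀, hx₀, hmin⟩ := hKc.exists_isMinOn hKne hFc.continuousOn
  obtain ⟨x₁, hx₁, hmax⟩ := hKc.exists_isMaxOn hKne hFc.continuousOn
  have hInf : sInf (F '' K) = F x₀ :=
    IsLeast.csInf_eq ⟨⟨x₀, hx₀, rfl⟩, by rintro _ ⟨x, hx, rfl⟩; exact hmin hx⟩
  have hmin' : ∀ x ∈ K, F x₀ ≤ F x := fun x hx => hmin hx
  have hmax' : ∀ x ∈ K, F x ≤ F x₁ := fun x hx => hmax hx
  set M := 2 * (F x₁ - F x₀ + 1) with hM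
  have hM0 : 0 < M := by linarith [hmin' x₁ hx₁]
  set u : EuclideanSpace ℝ (Fin n) → ℝ := fun x => (F x - F x₀) / M with hu
  have huc : Continuous u := by fun_prop
  have hu0 : ∀ x ∈ K, 0 ≤ u x := fun x hx => div_nonneg (by linarith [hmin' x hx]) hM0.le
  have hu1 : ∀ x ∈ K, u x ≤ 1 / 2 := fun x hx => by
    rw [hu, div_le_iff₀ hM0]; linarith [hmax' x hx]
  obtain ⟨C, hC, hCvol⟩ :=
    exists_le_volume_sublevel hKc hKa hx₀ (hFd x₀) (s := M / 4) (by positivity)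
  set d := f.totalDegree + 1 with hd
  have hd0 : (0 : ℝ) < d := by positivity
  set V := volume.real K with hV
  have hlog2 : 0 < Real.log 2 := Real.log_pos (by norm_num)
  refine ⟨M * (d * (n + 1) / 2 + 8 * V / (C * Real.log 2)), by positivity, fun r hr => ?_⟩
  have hr2 : (2 : ℝ) ≤ r := by exact_mod_cast hr
  have hr0 : (0 : ℝ) < r := by linarith
  have hlogr : Real.log 2 ≤ Real.log r := Real.log_le_log (by norm_num) hr2
  set k := r / d with hk
  have hrd : r < d * (k + 1) := Nat.lt_mul_div_succ r (by omega)
  have hkd : k * d ≤ r := Nat.div_mul_le_self r d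
  set τ := d * (n + 1) * Real.log r / (2 * r) with hτ
  have hτ0 : 0 ≤ τ := by positivity
  set p : MvPolynomial (Fin n) ℝ :=
    (MvPolynomial.C 1 - MvPolynomial.C M⁻¹ * (f - MvPolynomial.C (F x₀))) ^ k with hp
  have hpdeg : p.totalDegree ≤ r := by
    refine (MvPolynomial.totalDegree_pow _ _).trans ((Nat.mul_le_mul_left k ?_).trans hkd)
    refine (MvPolynomial.totalDegree_sub _ _).trans (max_le (by simp) ?_)
    refine (MvPolynomial.totalDegree_mul _ _).trans ?_
    have := MvPolynomial.totalDegree_sub f (MvPolynomial.C (F x₀))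
    simp only [MvPolynomial.totalDegree_C] at this ⊢
    omega
  have hpe : ∀ x : EuclideanSpace ℝ (Fin n),
      MvPolynomial.eval (fun i => x i) p ^ 2 = (1 - u x) ^ (2 * k) := fun x => by
    simp only [hp, hu, map_pow, map_sub, map_mul, MvPolynomial.eval_C, ← hF]
    rw [← pow_mul, mul_comm k 2, div_eq_inv_mul]
  set D := ∫ x in K, (1 - u x) ^ (2 * k) with hD
  have hint : ∀ {g : EuclideanSpace ℝ (Fin n) → ℝ}, Continuous g → IntegrableOn g K :=
    fun hg => hg.continuousOn.integrableOn_compact hKc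
  have hDlow : C / (2 * (r : ℝ) ^ n) ≤ D := by
    set S := K ∩ {x | F x ≤ F x₀ + M / 4 / r} with hS
    have hSm : MeasurableSet S :=
      hKc.measurableSet.inter (measurableSet_le hFc.measurable measurable_const)
    have hSK : S ⊆ K := Set.inter_subset_left
    have hSfin : volume S ≠ ⊤ := (measure_mono hSK |>.trans_lt hKc.measure_lt_top).ne
    have hge : ∀ x ∈ S, (1 / 2 : ℝ) ≤ (1 - u x) ^ (2 * k) := fun x hx => by
      have h1 : u x ≤ 1 / (4 * r) := by
        have hx2 : F x ≤ F x₀ + M / 4 / r := hx.2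
        rw [hu, div_le_iff₀ hM0]
        have : 1 / (4 * r) * M = M / 4 / r := by field_simp
        linarith
      have h2 : (k : ℝ) ≤ r := by exact_mod_cast Nat.div_le_self r d
      have h3 : k * u x ≤ r * (1 / (4 * r)) :=
        mul_le_mul h2 h1 (hu0 x (hSK hx)) hr0.le
      have h4 : r * (1 / (4 * r)) = (1 / 4 : ℝ) := by field_simp
      have h5 := one_add_mul_le_pow (a := -u x) (by linarith [hu1 x (hSK hx)]) (2 * k)
      push_cast at h5
      rw [← sub_eq_add_neg] at h5
      linarith
    calc C / (2 * (r : ℝ) ^ n) = 1 / 2 * (C / (r : ℝ) ^ n) := by field_simp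
      _ ≤ 1 / 2 * volume.real S := by gcongr; exact hCvol r (by omega)
      _ = ∫ _ in S, (1 / 2 : ℝ) := by simp [mul_comm]
      _ ≤ ∫ x in S, (1 - u x) ^ (2 * k) :=
          setIntegral_mono_on (integrableOn_const hSfin)
            ((hint (by fun_prop)).mono_set hSK) hSm hge
      _ ≤ D := setIntegral_mono_set (hint (by fun_prop))
          (ae_of_all _ fun x => (even_two_mul k).pow_nonneg _) hSK.eventuallyLE
  have hD0 : 0 < D := lt_of_lt_of_le (by positivity) hDlow
  have hexp : Real.exp (-(2 * r * τ / d)) = 1 / (r : ℝ) ^ (n + 1) := by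
    have : 2 * r * τ / d = ((n + 1 : ℕ) : ℝ) * Real.log r := by
      rw [hτ]; push_cast; field_simp
    rw [this, Real.exp_neg, Real.exp_nat_mul, Real.exp_log hr0, one_div]
  have hN : ∫ x in K, u x * (1 - u x) ^ (2 * k) ≤ τ * D + 4 * (1 / (r : ℝ) ^ (n + 1)) * V := by
    calc ∫ x in K, u x * (1 - u x) ^ (2 * k)
        ≤ ∫ x in K, (τ * (1 - u x) ^ (2 * k) + 4 * (1 / (r : ℝ) ^ (n + 1))) := by
          refine setIntegral_mono_on (hint (by fun_prop)) (hint (by fun_prop))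
            hKc.measurableSet fun x hx => ?_
          rw [← hexp]
          exact mul_one_sub_pow_le (by omega) hrd (hu1 x hx) hτ0
      _ = _ := by
          rw [integral_add (hint (by fun_prop)) (hint (by fun_prop)), integral_const_mul]
          simp [hV, hD, mul_comm]
  have htail : 4 * (1 / (r : ℝ) ^ (n + 1)) * V ≤ 8 * V / (C * Real.log 2) * Real.log r / r * D := by
    calc 4 * (1 / (r : ℝ) ^ (n + 1)) * V
        = 8 * V / (C * Real.log 2) * Real.log 2 / r * (C / (2 * (r : ℝ) ^ n)) := by
          field_simp; ring
      _ ≤ _ := by gcongr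
  have hlas := lasserre_le_of_sq hKc hFc hmin' p hpdeg (by simpa only [hpe] using hD0)
  simp only [hpe, ← hD] at hlas
  have hFu : ∫ x in K, F x * (1 - u x) ^ (2 * k)
      = F x₀ * D + M * ∫ x in K, u x * (1 - u x) ^ (2 * k) := by
    rw [hD, ← integral_const_mul, ← integral_const_mul,
      ← integral_add (hint (by fun_prop)) (hint (by fun_prop))]
    congr 1
    ext x
    have : F x = F x₀ + M * u x := by rw [hu]; field_simp; ring
    rw [this]
    ring
  rw [lasserreError, hInf]
  refine (sub_le_sub_right hlas _).trans ?_
  rw [hFu, sub_le_iff_le_add, div_le_iff₀ hD0]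
  have := mul_le_mul_of_nonneg_left (hN.trans (add_le_add_right htail _)) hM0.le
  refine (add_le_add_right this _).trans (le_of_eq ?_)
  rw [hτ]
  field_simp
  ring
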